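/- arXiv:2203.00243 — 2 statements merged into one kernel-verified Lean document; each statement's English description precedes it below -/
import Mathlib

section
/- For every m ≥ 0 and 0 ≤ j ≤ p, S_{[m(p+1)+j, j]} = Σ_{i₁=0}^{j} Σ_{i₂=0}^{i₁+p} Σ_{i₃=0}^{i₂+p} ⋯ Σ_{i_m=0}^{i_{m−1}+p} Π_{k=1}^{m} a_{i_k}, where the right-hand side is understood to be 1 when m = 0. (These are the generalized p-Stieltjes–Rogers polynomials, a.k.a. genetic sums.) -/
open Finset

/-- The height of the path `γ` after `k` steps, starting at height `h0`.
A step with `γ i = false` is an upstep (height change `+1`) and a step with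
`γ i = true` is a downstep by `p` units (height change `-p`). -/
def htB (p : ℕ) {n : ℕ} (h0 : ℤ) (γ : Fin n → Bool) (k : ℕ) : ℤ :=
  h0 + ∑ i ∈ Finset.range k,
    (if h : i < n then (if γ ⟨i, h⟩ then -(p : ℤ) else 1) else 0)

/-- The weight of the path `γ` started at height `h0`: upsteps have weight `1` and
a downstep from height `m` has weight `a (m - p)`, i.e. `a` evaluated at its final
height. -/
noncomputable def wtB (a : ℤ → ℂ) (p : ℕ) {n : ℕ} (h0 : ℤ) (γ : Fin n → Bool) : ℂ :=
  ∏ i : Fin n, if γ i then a (htB p h0 γ ((i : ℕ) + 1)) else 1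

open Classical in
/-- `ℛ_{[n,j]}`: all paths of length `n` from `(0,0)` to `(n,j)` with upsteps and
downsteps by `p` (heights may be negative). -/
noncomputable def Rset (p n j : ℕ) : Finset (Fin n → Bool) :=
  Finset.univ.filter fun γ => htB p 0 γ n = (j : ℤ)

open Classical in
/-- `𝒮_{[n,j]}`: the paths in `ℛ_{[n,j]}` whose vertices all have height `≥ 0`
(partial `p`-Dyck paths). -/
noncomputable def Sset (p n j : ℕ) : Finset (Fin n → Bool) :=
  Finset.univ.filter fun γ => htB p 0 γ n = (j : ℤ) ∧ ∀ k ≤ n, 0 ≤ htB p 0 γ k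

open Classical in
/-- `Ŝ_{[n,j]}`: the paths of length `n` from `(0,-j)` to `(n,0)` whose vertices
all have height `≤ 0`. -/
noncomputable def Shatset (p n j : ℕ) : Finset (Fin n → Bool) :=
  Finset.univ.filter fun γ =>
    htB p (-(j : ℤ)) γ n = 0 ∧ ∀ k ≤ n, htB p (-(j : ℤ)) γ k ≤ 0

/-- The weight polynomial `R_{[n,j]} = Σ_{γ ∈ ℛ_{[n,j]}} w(γ)`. -/
noncomputable def Rpoly (a : ℤ → ℂ) (p n j : ℕ) : ℂ :=
  ∑ γ ∈ Rset p n j, wtB a p 0 γ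

/-- The weight polynomial `S^{(q)}_{[n,j]}` (so `S_{[n,j]} = Spoly a p 0 n j`):
the sum over `γ ∈ 𝒮_{[n,j]}` of the weight of the upward shift `γ + q`. -/
noncomputable def Spoly (a : ℤ → ℂ) (p : ℕ) (q : ℤ) (n j : ℕ) : ℂ :=
  ∑ γ ∈ Sset p n j, wtB a p q γ

/-- The weight polynomial `T_{[n,j]} = Σ_{γ ∈ Ŝ_{[n,j]}} w(γ)`. -/
noncomputable def Tpoly (a : ℤ → ℂ) (p n j : ℕ) : ℂ :=
  ∑ γ ∈ Shatset p n j, wtB a p (-(j : ℤ)) γ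


theorem htB_snoc_le (p : ℕ) {n : ℕ} (h0 : ℤ) (γ : Fin n → Bool) (b : Bool) (k : ℕ) (hk : k ≤ n) :
    htB p h0 (Fin.snoc (α := fun _ => Bool) γ b : Fin (n+1) → Bool) k = htB p h0 γ k := by
  unfold htB
  congr 1
  apply Finset.sum_congr rfl
  intro i hi
  have h1 : i < n := by have := Finset.mem_range.1 hi; omega
  have h2 : i < n + 1 := by omega
  have : (Fin.snoc (α := fun _ => Bool) γ b : Fin (n+1) → Bool) ⟨i, h2⟩ = γ ⟨i, h1⟩ := by
    simp [Fin.snoc, h1]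
  rw [dif_pos h1, dif_pos h2, this]

theorem htB_snoc_last (p : ℕ) {n : ℕ} (h0 : ℤ) (γ : Fin n → Bool) (b : Bool) :
    htB p h0 (Fin.snoc (α := fun _ => Bool) γ b : Fin (n+1) → Bool) (n+1)
      = htB p h0 γ n + (if b then -(p:ℤ) else 1) := by
  rw [← htB_snoc_le p h0 γ b n le_rfl]
  unfold htB
  rw [Finset.sum_range_succ, dif_pos (Nat.lt_succ_self n)]
  have : (Fin.snoc (α := fun _ => Bool) γ b : Fin (n+1) → Bool) ⟨n, Nat.lt_succ_self n⟩ = b := by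
    simp [Fin.snoc]
  rw [this, add_assoc]

theorem wtB_snoc (a : ℤ → ℂ) (p : ℕ) {n : ℕ} (h0 : ℤ) (γ : Fin n → Bool) (b : Bool) :
    wtB a p h0 (Fin.snoc (α := fun _ => Bool) γ b : Fin (n+1) → Bool)
      = wtB a p h0 γ * (if b then a (htB p h0 γ n - p) else 1) := by
  unfold wtB
  rw [Fin.prod_univ_castSucc]
  congr 1
  · apply Finset.prod_congr rfl
    intro i _
    rw [Fin.snoc_castSucc, Fin.val_castSucc, htB_snoc_le _ _ _ _ _ (by omega)]
  · rw [Fin.snoc_last, Fin.val_last, htB_snoc_last]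
    cases b <;> simp [sub_eq_add_neg]

open Classical in
noncomputable def FF (a : ℤ → ℂ) (p n : ℕ) (h : ℤ) : ℂ :=
  ∑ γ : Fin n → Bool, if (htB p 0 γ n = h ∧ ∀ k ≤ n, 0 ≤ htB p 0 γ k) then wtB a p 0 γ else 0

theorem FF_neg (a : ℤ → ℂ) (p n : ℕ) (h : ℤ) (hh : h < 0) : FF a p n h = 0 := by
  unfold FF
  apply Finset.sum_eq_zero
  intro γ _
  rw [if_neg]
  rintro ⟨h1, h2⟩
  have := h2 n le_rfl
  omega

theorem FF_zero (a : ℤ → ℂ) (p : ℕ) : FF a p 0 0 = 1 := by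
  simp [FF, htB, wtB]

theorem FF_zero_ne (a : ℤ → ℂ) (p : ℕ) (h : ℤ) (hh : h ≠ 0) : FF a p 0 h = 0 := by
  simp [FF, htB, wtB, hh.symm]

theorem FF_succ (a : ℤ → ℂ) (p n : ℕ) (h : ℤ) (hh : 0 ≤ h) :
    FF a p (n+1) h = FF a p n (h-1) + a h * FF a p n (h+p) := by
  unfold FF
  rw [← (Fin.snocEquiv (fun _ : Fin (n+1) => Bool)).sum_comp, Fintype.sum_prod_type,
    Fintype.sum_bool, Finset.mul_sum]
  refine (add_comm _ _).trans ?_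
  have key : ∀ (b : Bool) (γ : Fin n → Bool),
      (htB p 0 (Fin.snoc (α := fun _ => Bool) γ b : Fin (n+1) → Bool) (n+1) = h ∧
        ∀ k ≤ n+1, 0 ≤ htB p 0 (Fin.snoc (α := fun _ => Bool) γ b : Fin (n+1) → Bool) k) ↔
      (htB p 0 γ n = h - (if b then -(p:ℤ) else 1) ∧ ∀ k ≤ n, 0 ≤ htB p 0 γ k) := by
    intro b γ
    rw [htB_snoc_last]
    constructor
    · rintro ⟨h1, h2⟩
      refine ⟨by omega, fun k hk => ?_⟩
      rw [← htB_snoc_le p 0 γ b k hk]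
      exact h2 k (by omega)
    · rintro ⟨h1, h2⟩
      refine ⟨by omega, fun k hk => ?_⟩
      rcases Nat.lt_or_ge n k with h3 | h3
      · obtain rfl : k = n + 1 := by omega
        rw [htB_snoc_last]; omega
      · rw [htB_snoc_le p 0 γ b k h3]; exact h2 k h3
  congr 1
  · apply Finset.sum_congr rfl
    intro γ _
    have := key false γ
    by_cases hc : (htB p 0 γ n = h - 1 ∧ ∀ k ≤ n, 0 ≤ htB p 0 γ k)
    · rw [if_pos hc]
      refine (if_pos (this.2 (by simpa using hc))).trans ((wtB_snoc a p 0 γ false).trans ?_)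
      simp
    · rw [if_neg hc]
      exact if_neg (fun h' => hc (by simpa using this.1 h'))
  · apply Finset.sum_congr rfl
    intro γ _
    have := key true γ
    by_cases hc : (htB p 0 γ n = h + p ∧ ∀ k ≤ n, 0 ≤ htB p 0 γ k)
    · rw [if_pos hc]
      refine (if_pos (this.2 (by simpa using hc))).trans ((wtB_snoc a p 0 γ true).trans ?_)
      rw [hc.1, add_sub_cancel_right, mul_comm]
      simp
    · rw [if_neg hc, mul_zero]
      exact if_neg (fun h' => hc (by simpa using this.1 h'))

theorem FF_big (a : ℤ → ℂ) (p n : ℕ) : ∀ h : ℤ, (n:ℤ) < h → FF a p n h = 0 := by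
  induction n with
  | zero => intro h hh; exact FF_zero_ne a p h (by simp at hh; omega)
  | succ n ih =>
    intro h hh
    push_cast at hh
    rw [FF_succ _ _ _ _ (by omega), ih _ (by omega), ih _ (by omega)]; simp

noncomputable def GG (a : ℤ → ℂ) (p : ℕ) : ℕ → ℤ → ℂ
  | 0, _ => 1
  | m+1, J => ∑ i ∈ Finset.Icc 0 J, a i * GG a p m (i + p)

theorem GG_step (a : ℤ → ℂ) (p m : ℕ) (J : ℤ) (hJ : 0 ≤ J) :
    GG a p (m+1) J = GG a p (m+1) (J-1) + a J * GG a p m (J + p) := by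
  have : Finset.Icc (0:ℤ) J = insert J (Finset.Icc 0 (J-1)) := by
    ext x; simp; omega
  rw [GG, GG, this, Finset.sum_insert (by simp), add_comm]

theorem FF_eq_GG (a : ℤ → ℂ) (p n : ℕ) : ∀ (m : ℕ) (h : ℤ), 0 ≤ h →
    (n:ℤ) = m * (p+1) + h → FF a p n h = GG a p m h := by
  induction n with
  | zero =>
    intro m h hh hn
    have h1 : (0:ℤ) ≤ m * p := by positivity
    have h2 : m = 0 := by push_cast at hn; nlinarith
    subst h2
    obtain rfl : h = 0 := by simpa using hn.symm
    rw [FF_zero, GG]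
  | succ n ih =>
    intro m h hh hn
    push_cast at hn
    rw [FF_succ _ _ _ _ hh]
    cases m with
    | zero =>
      simp at hn
      rw [FF_big a p n (h+p) (by omega), ih 0 (h-1) (by omega) (by push_cast; omega)]
      simp [GG]
    | succ m =>
      rw [GG_step _ _ _ _ hh, ih m (h+p) (by omega) (by push_cast at hn; linarith)]
      congr 1
      rcases hh.eq_or_lt with h0 | h0
      · rw [FF_neg _ _ _ _ (by omega), ← h0]; simp [GG]
      · exact ih (m+1) (h-1) (by omega) (by linarith)

def AA (p m : ℕ) (J : ℤ) : Set (Fin m → ℤ) := {i : Fin m → ℤ |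
        ∀ k : Fin m,
          0 ≤ i k ∧
          ((k : ℕ) = 0 → i k ≤ J) ∧
          ∀ k' : Fin m, (k' : ℕ) = (k : ℕ) + 1 → i k' ≤ i k + p}

theorem AA_succ (p m : ℕ) (J : ℤ) : AA p (m+1) J =
    ⋃ x ∈ Set.Icc (0:ℤ) J,
      (fun i => (Fin.cons x i : Fin (m+1) → ℤ)) '' AA p m (x + p) := by
  ext f
  simp only [Set.mem_iUnion, Set.mem_image, exists_prop, Set.mem_Icc]
  constructor
  · intro hf
    refine ⟨f 0, ⟨(hf 0).1, (hf 0).2.1 rfl⟩, Fin.tail f, ?_, Fin.cons_self_tail f⟩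
    intro k
    refine ⟨(hf k.succ).1, ?_, ?_⟩
    · intro hk
      exact (hf 0).2.2 k.succ (by simp [hk])
    · intro k' hk'
      exact (hf k.succ).2.2 k'.succ (by simp [hk'])
  · rintro ⟨x, ⟨h0, hJ⟩, g, hg, rfl⟩
    intro k
    refine Fin.cases ?_ (fun k => ?_) k
    · refine ⟨h0, fun _ => hJ, ?_⟩
      intro k'
      refine Fin.cases ?_ (fun k' => ?_) k'
      · simp
      · intro h
        simp only [Fin.cons_succ, Fin.cons_zero]
        exact (hg k').2.1 (by simpa using h)
    · refine ⟨by simpa using (hg k).1, by simp, ?_⟩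
      intro k'
      refine Fin.cases ?_ (fun k' => ?_) k'
      · simp
      · intro h
        simp only [Fin.cons_succ]
        exact (hg k).2.2 k' (by simpa using h)

theorem AA_finite (p m : ℕ) : ∀ J : ℤ, (AA p m J).Finite := by
  induction m with
  | zero => intro J; exact Set.toFinite _
  | succ m ih =>
    intro J
    rw [AA_succ]
    exact (Set.finite_Icc _ _).biUnion fun x _ => (ih _).image _

theorem AA_sum (a : ℤ → ℂ) (p m : ℕ) : ∀ J : ℤ,
    ∑ᶠ i ∈ AA p m J, ∏ k, a (i k) = GG a p m J := by
  induction m with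
  | zero =>
    intro J
    have : AA p 0 J = {Fin.elim0} := by
      ext f; simp [AA, Subsingleton.elim f Fin.elim0]
    rw [this, finsum_mem_singleton]; simp [GG]
  | succ m ih =>
    intro J
    rw [AA_succ, finsum_mem_biUnion ?_ (Set.finite_Icc _ _)
      (fun x _ => (AA_finite p m _).image _), GG, ← Finset.coe_Icc, finsum_mem_coe_finset]
    · apply Finset.sum_congr rfl
      intro x _
      rw [finsum_mem_image (fun _ _ _ _ h => (Fin.cons_right_injective (α := fun _ => ℤ) x h)), ← ih, 
        mul_finsum_mem]
      simp [Fin.prod_univ_succ]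
    · intro x _ y _ hxy
      rw [Function.onFun, Set.disjoint_left]
      rintro _ ⟨g, _, rfl⟩ ⟨g', _, h⟩
      exact hxy (by simpa using (congrFun h 0).symm)

/-- For every `m ≥ 0` and `0 ≤ j ≤ p`,
`S_{[m(p+1)+j,j]} = Σ_{i₁=0}^{j} Σ_{i₂=0}^{i₁+p} ⋯ Σ_{i_m=0}^{i_{m-1}+p} Π_{k=1}^{m} a_{i_k}`
(the empty sum of products being `1` when `m = 0`); the nested sum is expressed as a
sum over the tuples `(i_0, …, i_{m-1})` satisfying the corresponding inequalities. -/
theorem stmt7 (p : ℕ) (hp : 1 ≤ p) (a : ℤ → ℂ) (m j : ℕ) (hj : j ≤ p) :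
    Spoly a p 0 (m * (p + 1) + j) j =
      ∑ᶠ i ∈ {i : Fin m → ℤ |
        ∀ k : Fin m,
          0 ≤ i k ∧
          ((k : ℕ) = 0 → i k ≤ (j : ℤ)) ∧
          ∀ k' : Fin m, (k' : ℕ) = (k : ℕ) + 1 → i k' ≤ i k + p},
        ∏ k, a (i k) := by
  have h1 : Spoly a p 0 (m * (p + 1) + j) j = FF a p (m * (p + 1) + j) j := by
    unfold Spoly Sset FF
    rw [Finset.sum_filter]
  rw [h1, FF_eq_GG a p _ m j (by omega) (by push_cast; ring), ← AA_sum]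
  rfl
end

section
/- Let 𝒲 be the linear endomorphism of the space ℤ →₀ ℂ of finitely supported two-sided sequences determined on the standard basis (ê_n)_{n∈ℤ} by 𝒲 ê_n = ê_{n−1} + Σ_{k=0}^{p} a^{(k)}_n ê_{n+k} for all n ∈ ℤ (the two-sided banded Hessenberg operator). Then for every n ≥ 0 and every 0 ≤ j ≤ p, the coefficient of ê_0 in 𝒲^n ê_j equals the weight polynomial W_{[n,j]}; that is, ⟨𝒲^n ê_j, ê_0⟩ = W_{[n,j]}. -/
open Finset

/-- The height of the path `γ` after `k` steps, starting at height `h0`.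
A step encoded by `v : Fin (p + 2)` changes the height by `1 - v`:
`v = 0` is an upstep, `v = 1` a level step and `v = j + 1` a downstep of size `j`
(for `1 ≤ j ≤ p`). -/
def ht {p n : ℕ} (h0 : ℤ) (γ : Fin n → Fin (p + 2)) (k : ℕ) : ℤ :=
  h0 + ∑ i ∈ Finset.range k, (if h : i < n then 1 - ((γ ⟨i, h⟩ : ℕ) : ℤ) else 0)

/-- The weight of the path `γ` started at height `h0`: upsteps have weight `1`,
a level step at height `m` has weight `a 0 m`, and a downstep of size `j` from
height `m` has weight `a j (m - j)`, i.e. `a j` evaluated at the final height. -/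
noncomputable def wt (a : ℕ → ℤ → ℂ) {p n : ℕ} (h0 : ℤ) (γ : Fin n → Fin (p + 2)) : ℂ :=
  ∏ i : Fin n,
    if (γ i : ℕ) = 0 then 1 else a ((γ i : ℕ) - 1) (ht h0 γ ((i : ℕ) + 1))

open Classical in
/-- `𝒟_{[n,j]}`: the paths of length `n` from `(0,0)` to `(n,j)` whose vertices
all have height `≥ 0`. -/
noncomputable def Dset (p n j : ℕ) : Finset (Fin n → Fin (p + 2)) :=
  Finset.univ.filter fun γ => ht 0 γ n = (j : ℤ) ∧ ∀ k ≤ n, 0 ≤ ht 0 γ k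

open Classical in
/-- `𝒫_{[n,j]}`: all paths of length `n` from `(0,0)` to `(n,j)`. -/
noncomputable def Pset (p n j : ℕ) : Finset (Fin n → Fin (p + 2)) :=
  Finset.univ.filter fun γ => ht 0 γ n = (j : ℤ)

open Classical in
/-- `𝒟̂_{[n,j]}`: the paths of length `n` from `(0,-j)` to `(n,0)` whose vertices
all have height `≤ 0`. -/
noncomputable def Bhset (p n j : ℕ) : Finset (Fin n → Fin (p + 2)) :=
  Finset.univ.filter fun γ =>
    ht (-(j : ℤ)) γ n = 0 ∧ ∀ k ≤ n, ht (-(j : ℤ)) γ k ≤ 0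

/-- The weight polynomial `A^{(q)}_{[n,j]}` (so `A_{[n,j]} = Apoly a p 0 n j`):
the sum over `γ ∈ 𝒟_{[n,j]}` of the weight of the upward shift `γ + q`. -/
noncomputable def Apoly (a : ℕ → ℤ → ℂ) (p : ℕ) (q : ℤ) (n j : ℕ) : ℂ :=
  ∑ γ ∈ Dset p n j, wt a q γ

/-- The weight polynomial `W_{[n,j]} = Σ_{γ ∈ 𝒫_{[n,j]}} w(γ)`. -/
noncomputable def Wpoly (a : ℕ → ℤ → ℂ) (p n j : ℕ) : ℂ :=
  ∑ γ ∈ Pset p n j, wt a 0 γ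

/-- The weight polynomial `B^{(q)}_{[n,j]}`: the sum over `γ ∈ 𝒟̂_{[n,j]}` of the
weight of the downward shift `γ - q` (a path starting at height `-j - q`). -/
noncomputable def Bpoly (a : ℕ → ℤ → ℂ) (p : ℕ) (q : ℤ) (n j : ℕ) : ℂ :=
  ∑ γ ∈ Bhset p n j, wt a (-(j : ℤ) - q) γ

lemma ht_snoc_le {p n : ℕ} (h0 : ℤ) (γ : Fin n → Fin (p + 2)) (v : Fin (p + 2)) (k : ℕ)
    (hk : k ≤ n) :
    ht h0 (Fin.snoc γ v : Fin (n + 1) → Fin (p + 2)) k = ht h0 γ k := by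
  unfold ht
  congr 1
  apply Finset.sum_congr rfl
  intro i hi
  have hi' : i < n := lt_of_lt_of_le (Finset.mem_range.1 hi) hk
  have h2 : i < n + 1 := by omega
  rw [dif_pos hi', dif_pos h2]
  have : (⟨i, h2⟩ : Fin (n + 1)) = Fin.castSucc ⟨i, hi'⟩ := rfl
  rw [this, Fin.snoc_castSucc (α := fun _ => Fin (p + 2))]

lemma ht_snoc_last {p n : ℕ} (h0 : ℤ) (γ : Fin n → Fin (p + 2)) (v : Fin (p + 2)) :
    ht h0 (Fin.snoc γ v : Fin (n + 1) → Fin (p + 2)) (n + 1) = ht h0 γ n + (1 - ((v : ℕ) : ℤ)) := by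
  rw [← ht_snoc_le h0 γ v n le_rfl]
  unfold ht
  rw [Finset.sum_range_succ, dif_pos (Nat.lt_succ_self n)]
  have : (⟨n, Nat.lt_succ_self n⟩ : Fin (n + 1)) = Fin.last n := rfl
  rw [this, Fin.snoc_last (α := fun _ => Fin (p + 2))]
  ring

lemma wt_snoc (a : ℕ → ℤ → ℂ) {p n : ℕ} (h0 : ℤ) (γ : Fin n → Fin (p + 2)) (v : Fin (p + 2)) :
    wt a h0 (Fin.snoc γ v : Fin (n + 1) → Fin (p + 2)) =
      wt a h0 γ * (if (v : ℕ) = 0 then 1 else a ((v : ℕ) - 1) (ht h0 γ n + (1 - ((v : ℕ) : ℤ)))) := by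
  unfold wt
  rw [Fin.prod_univ_castSucc]
  congr 1
  · apply Finset.prod_congr rfl
    intro i _
    rw [Fin.snoc_castSucc (α := fun _ => Fin (p + 2)), Fin.val_castSucc,
      ht_snoc_le h0 γ v _ (by omega)]
  · rw [Fin.snoc_last (α := fun _ => Fin (p + 2)), Fin.val_last, ht_snoc_last]

lemma sum_snoc {p n : ℕ} (f : (Fin (n + 1) → Fin (p + 2)) → ℂ) :
    ∑ γ, f γ = ∑ v : Fin (p + 2), ∑ γ : Fin n → Fin (p + 2), f (Fin.snoc γ v) := by
  rw [← Fintype.sum_prod_type']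
  exact (Fintype.sum_equiv (Fin.snocEquiv (fun _ : Fin (n + 1) => Fin (p + 2))) _ _
    (fun _ => rfl)).symm

lemma pow_coeff (p : ℕ) (a : ℕ → ℤ → ℂ)
    (Wop : Module.End ℂ (ℤ →₀ ℂ))
    (hW : ∀ m : ℤ,
      Wop (Finsupp.single m 1) =
        Finsupp.single (m - 1) 1 +
          ∑ k ∈ Finset.range (p + 1), Finsupp.single (m + k) (a k m))
    (n : ℕ) : ∀ m : ℤ, ((Wop ^ n) (Finsupp.single m 1)) 0 =
      ∑ γ : Fin n → Fin (p + 2), if ht 0 γ n = m then wt a 0 γ else 0 := by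
  induction n with
  | zero =>
    intro m
    simp [ht, wt, Finsupp.single_apply, eq_comm]
  | succ n ih =>
    intro m
    have hs : ∀ (x : ℤ) (c : ℂ), ((Wop ^ n) (Finsupp.single x c)) 0 =
        c * ((Wop ^ n) (Finsupp.single x 1)) 0 := by
      intro x c
      have : (Finsupp.single x c : ℤ →₀ ℂ) = c • Finsupp.single x 1 := by simp
      rw [this, map_smul]
      rfl
    rw [pow_succ, Module.End.mul_apply, hW, map_add, map_sum, Finsupp.add_apply,
      Finsupp.finsetSum_apply, ih, sum_snoc, Fin.sum_univ_succ, Finset.sum_range]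
    congr 1
    · apply Finset.sum_congr rfl
      intro γ _
      rw [ht_snoc_last, wt_snoc]
      have : ht 0 γ n = m - 1 ↔ ht 0 γ n + (1 - (((0 : Fin (p + 2)) : ℕ) : ℤ)) = m := by
        simp; omega
      simp only [this]
      simp
    · apply Finset.sum_congr rfl
      intro k _
      rw [hs, ih, Finset.mul_sum]
      apply Finset.sum_congr rfl
      intro γ _
      rw [ht_snoc_last, wt_snoc]
      have : ht 0 γ n = m + ((k : ℕ) : ℤ) ↔ ht 0 γ n + (1 - ((k.succ : ℕ) : ℤ)) = m := by
        rw [Fin.val_succ]; push_cast; omega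
      simp only [this]
      split_ifs with h1 h2
      · simp at h2
      · rw [h1, Fin.val_succ, Nat.add_sub_cancel, mul_comm]
      · simp

/-- Let `𝒲` be the linear endomorphism of `ℤ →₀ ℂ` determined on the standard basis by
`𝒲 ê_n = ê_{n-1} + Σ_{k=0}^{p} a^{(k)}_n ê_{n+k}` for all `n ∈ ℤ`.
Then `⟨𝒲^n ê_j, ê_0⟩ = W_{[n,j]}` for all `n ≥ 0` and `0 ≤ j ≤ p`. -/
theorem stmt19 (p : ℕ) (hp : 1 ≤ p) (a : ℕ → ℤ → ℂ)
    (Wop : Module.End ℂ (ℤ →₀ ℂ))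
    (hW : ∀ m : ℤ,
      Wop (Finsupp.single m 1) =
        Finsupp.single (m - 1) 1 +
          ∑ k ∈ Finset.range (p + 1), Finsupp.single (m + k) (a k m))
    (n j : ℕ) (hj : j ≤ p) :
    ((Wop ^ n) (Finsupp.single (j : ℤ) 1)) 0 = Wpoly a p n j := by
  rw [pow_coeff p a Wop hW n j, Wpoly, Pset, Finset.sum_filter]
end
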